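/- Let n ≥ 3 be an integer and c > 0. There exists ε₀ ∈ (0, 1] such that the following holds for every ε ∈ (0, ε₀]. Define f_ε : ℝ^n_+ → ℝ by f_ε(x) = exp(−(n+2)/(2ε − |x + ε e_n|)) if |x + ε e_n| < 2ε, and f_ε(x) = 0 otherwise. Then f_ε is smooth on ℝ^n_+, nonnegative, and supported in {x ∈ ℝ^n_+ : |x + ε e_n| ≤ 2ε}; and for every C¹ metric g on ℝ^n_+ satisfying |g(x) − Id| ≤ c·ε and |Dg(x)| ≤ c for all x ∈ ℝ^n_+ with |x + ε e_n| ≤ 2ε, one has Δ_g f_ε(x) ≥ 0 for all x ∈ ℝ^n_+, with strict inequality Δ_g f_ε(x) > 0 whenever |x + ε e_n| < 2ε. -/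

import Mathlib

open MeasureTheory Real Filter Topology Finset

noncomputable section

/-- Partial derivative of `f` in the `i`-th coordinate direction. -/
def pd {n : ℕ} (i : Fin n) (f : EuclideanSpace ℝ (Fin n) → ℝ)
    (x : EuclideanSpace ℝ (Fin n)) : ℝ :=
  fderiv ℝ f x (EuclideanSpace.single i 1)

/-- The closed upper half-space `{x : x iN ≥ 0}`. -/
def halfSpace {n : ℕ} (iN : Fin n) : Set (EuclideanSpace ℝ (Fin n)) :=
  {x | 0 ≤ x iN}

/-- The boundary hyperplane `{x : x iN = 0}`. -/
def bdry {n : ℕ} (iN : Fin n) : Set (EuclideanSpace ℝ (Fin n)) :=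
  {x | x iN = 0}

/-- Christoffel symbols `Γ^k_{ij}` of a metric `g`. -/
def christoffel {n : ℕ} (g : EuclideanSpace ℝ (Fin n) → Matrix (Fin n) (Fin n) ℝ)
    (k i j : Fin n) (x : EuclideanSpace ℝ (Fin n)) : ℝ :=
  (1 / 2) * ∑ l, (g x)⁻¹ k l *
    (pd i (fun y => g y j l) x + pd j (fun y => g y i l) x - pd l (fun y => g y i j) x)

/-- The Laplace–Beltrami operator of the metric `g`. -/
def laplaceBeltrami {n : ℕ} (g : EuclideanSpace ℝ (Fin n) → Matrix (Fin n) (Fin n) ℝ)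
    (u : EuclideanSpace ℝ (Fin n) → ℝ) (x : EuclideanSpace ℝ (Fin n)) : ℝ :=
  ∑ i, ∑ j, (g x)⁻¹ i j *
    (pd i (pd j u) x - ∑ k, christoffel g k i j x * pd k u x)

/-- The inward-pointing `g`-unit normal to the boundary hyperplane, as a vector. -/
def nuVec {n : ℕ} (iN : Fin n) (g : EuclideanSpace ℝ (Fin n) → Matrix (Fin n) (Fin n) ℝ)
    (y : EuclideanSpace ℝ (Fin n)) : EuclideanSpace ℝ (Fin n) :=
  (WithLp.equiv 2 (Fin n → ℝ)).symm fun i =>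
    (g y)⁻¹ i iN / Real.sqrt ((g y)⁻¹ iN iN)

/-- Normal derivative `D_{ν_g} u` at a boundary point. -/
def nuDeriv {n : ℕ} (iN : Fin n) (g : EuclideanSpace ℝ (Fin n) → Matrix (Fin n) (Fin n) ℝ)
    (u : EuclideanSpace ℝ (Fin n) → ℝ) (y : EuclideanSpace ℝ (Fin n)) : ℝ :=
  ∑ i, nuVec iN g y i * pd i u y

/-- `g` is a `C^m` Riemannian metric on the half-space. -/
def IsCmMetric {n : ℕ} (m : ℕ) (iN : Fin n)
    (g : EuclideanSpace ℝ (Fin n) → Matrix (Fin n) (Fin n) ℝ) : Prop :=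
  (∀ i j, ContDiffOn ℝ m (fun y => g y i j) (halfSpace iN)) ∧
    ∀ x ∈ halfSpace iN, (g x).IsSymm ∧ (g x).PosDef

/-- `g` is `C²`-asymptotically flat of rate `τ` on the half-space. -/
def IsAsymptoticallyFlat {n : ℕ} (iN : Fin n) (τ : ℝ)
    (g : EuclideanSpace ℝ (Fin n) → Matrix (Fin n) (Fin n) ℝ) : Prop :=
  ∃ C₀ > 0, ∀ x ∈ halfSpace iN, 1 ≤ ‖x‖ →
    (∀ i j, |g x i j - (1 : Matrix (Fin n) (Fin n) ℝ) i j| ≤ C₀ * ‖x‖ ^ (-τ)) ∧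
    (∀ i j k, |pd k (fun y => g y i j) x| ≤ C₀ * ‖x‖ ^ (-1 - τ)) ∧
    (∀ i j k l, |pd l (pd k (fun y => g y i j)) x| ≤ C₀ * ‖x‖ ^ (-2 - τ))

/-- The closed upper half-sphere of radius `lam`. -/
def halfSphere {n : ℕ} (iN : Fin n) (lam : ℝ) : Set (EuclideanSpace ℝ (Fin n)) :=
  {x | ‖x‖ = lam ∧ 0 ≤ x iN}

/-- The flux integral `∫_{ℝⁿ₊ ∩ S_λ} Σᵢ xⁱ ∂ᵢu dμ(ḡ)`, with `dμ(ḡ)` the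
`(n-1)`-dimensional Euclidean (Hausdorff) surface measure. -/
def flux {n : ℕ} (iN : Fin n) (u : EuclideanSpace ℝ (Fin n) → ℝ) (lam : ℝ) : ℝ :=
  ∫ x in halfSphere iN lam, (∑ i, x i * pd i u x) ∂(μH[(n : ℝ) - 1])

/-- Euclidean norm of the gradient. -/
def gradNorm {n : ℕ} (u : EuclideanSpace ℝ (Fin n) → ℝ) (x : EuclideanSpace ℝ (Fin n)) : ℝ :=
  Real.sqrt (∑ i, (pd i u x) ^ 2)

/-- Frobenius norm of the Hessian. -/
def hessNorm {n : ℕ} (u : EuclideanSpace ℝ (Fin n) → ℝ) (x : EuclideanSpace ℝ (Fin n)) : ℝ :=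
  Real.sqrt (∑ i, ∑ j, (pd i (pd j u) x) ^ 2)

/-- The Euclidean Laplacian. -/
def euclLap {n : ℕ} (u : EuclideanSpace ℝ (Fin n) → ℝ) (x : EuclideanSpace ℝ (Fin n)) : ℝ :=
  ∑ i, pd i (pd i u) x

/-- The barrier function associated to `τ` and `η`. -/
def barrier {n : ℕ} (iN : Fin n) (τ : ℝ) (η : ℝ → ℝ)
    (x : EuclideanSpace ℝ (Fin n)) : ℝ :=
  -(Real.log ‖x‖)⁻¹ * ‖x‖ ^ ((2 : ℝ) - n) + η (x iN / ‖x‖) * ‖x‖ ^ ((2 : ℝ) - n - τ)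

/-- The Euclidean area of the unit `(n-1)`-sphere in `ℝⁿ`. -/
def sphereArea (n : ℕ) : ℝ :=
  (μH[(n : ℝ) - 1] (Metric.sphere (0 : EuclideanSpace ℝ (Fin n)) 1)).toReal

/-- The quantity whose limit (after normalization) is the half-space mass. -/
def massExpr {n : ℕ} (iN : Fin n)
    (g : EuclideanSpace ℝ (Fin n) → Matrix (Fin n) (Fin n) ℝ) (lam : ℝ) : ℝ :=
  lam⁻¹ *
    ((∫ x in halfSphere iN lam,
        (∑ i, ∑ j, x i * (pd j (fun y => g y i j) x - pd i (fun y => g y j j) x))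
        ∂(μH[(n : ℝ) - 1])) +
      ∫ x in {x : EuclideanSpace ℝ (Fin n) | ‖x‖ = lam ∧ x iN = 0},
        (∑ i ∈ Finset.univ.erase iN, x i * g x i iN) ∂(μH[(n : ℝ) - 2]))

/-- `m` is the half-space (ADM-type) mass of `g`. -/
def HasHalfSpaceMass {n : ℕ} (iN : Fin n)
    (g : EuclideanSpace ℝ (Fin n) → Matrix (Fin n) (Fin n) ℝ) (m : ℝ) : Prop :=
  Filter.Tendsto (fun lam => (2 * ((n : ℝ) - 1) * sphereArea n)⁻¹ * massExpr iN g lam)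
    Filter.atTop (nhds m)

/-- Membership in the weighted Hölder space `C^{2,α}_τ(ℝⁿ₊)`. -/
def MemC2AlphaTau {n : ℕ} (iN : Fin n) (α τ : ℝ)
    (u : EuclideanSpace ℝ (Fin n) → ℝ) : Prop :=
  ContDiffOn ℝ 2 u (halfSpace iN) ∧
  ∃ C₁ > 0,
    (∀ x ∈ halfSpace iN,
      |u x| ≤ C₁ * (1 + ‖x‖) ^ (-τ) ∧
      (∀ i, |pd i u x| ≤ C₁ * (1 + ‖x‖) ^ (-1 - τ)) ∧
      (∀ i j, |pd i (pd j u) x| ≤ C₁ * (1 + ‖x‖) ^ (-2 - τ))) ∧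
    ∀ x₁ ∈ halfSpace iN, ∀ x₂ ∈ halfSpace iN, 1 ≤ ‖x₁‖ → 2 * ‖x₁ - x₂‖ ≤ ‖x₁‖ →
      ∀ i j, |pd i (pd j u) x₁ - pd i (pd j u) x₂| ≤
        C₁ * ‖x₁ - x₂‖ ^ α * ‖x₁‖ ^ (-2 - τ - α)


/-- The bump function `f_ε` centered at `-ε eₙ`. -/
def bumpF {n : ℕ} (iN : Fin n) (ε : ℝ) (x : EuclideanSpace ℝ (Fin n)) : ℝ :=
  if ‖x + ε • EuclideanSpace.single iN (1 : ℝ)‖ < 2 * ε then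
    Real.exp (-((n : ℝ) + 2) / (2 * ε - ‖x + ε • EuclideanSpace.single iN (1 : ℝ)‖))
  else 0

section RadialFunctions

variable {n : ℕ}

theorem hasFDerivAt_norm_add_const {E : Type*} [NormedAddCommGroup E] [InnerProductSpace ℝ E]
    {x v : E} (h : x + v ≠ 0) :
    HasFDerivAt (fun z => ‖z + v‖) (‖x + v‖⁻¹ • innerSL ℝ (x + v)) x := by
  have h1 : HasFDerivAt (fun z : E => ‖z‖ ^ 2) (2 • innerSL ℝ (x + v)) (x + v) :=
    (hasStrictFDerivAt_norm_sq (x + v)).hasFDerivAt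
  have h2 := (h1.comp x ((hasFDerivAt_id x).add_const v)).sqrt
    (by simpa using h)
  have hr : ‖x + v‖ ≠ 0 := norm_ne_zero_iff.2 h
  convert h2 using 1
  · ext z
    simp
  · ext z
    simp
    field_simp

theorem hasFDerivAt_radial {φ : ℝ → ℝ} {φ' : ℝ} {x v : EuclideanSpace ℝ (Fin n)}
    (h : x + v ≠ 0) (hφ : HasDerivAt φ φ' ‖x + v‖) :
    HasFDerivAt (fun z => φ ‖z + v‖) (φ' • ‖x + v‖⁻¹ • innerSL ℝ (x + v)) x :=
  hφ.comp_hasFDerivAt x (hasFDerivAt_norm_add_const h)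

theorem pd_radial {φ : ℝ → ℝ} {φ' : ℝ} {x v : EuclideanSpace ℝ (Fin n)} (j : Fin n)
    (h : x + v ≠ 0) (hφ : HasDerivAt φ φ' ‖x + v‖) :
    pd j (fun z => φ ‖z + v‖) x = φ' / ‖x + v‖ * (x + v) j := by
  rw [pd, (hasFDerivAt_radial h hφ).fderiv]
  simp [EuclideanSpace.inner_single_right]
  ring

theorem pd_pd_radial {φ φ₁ φ₂ : ℝ → ℝ} {x v : EuclideanSpace ℝ (Fin n)} (i j : Fin n)
    (h : x + v ≠ 0) (h₁ : ∀ r, HasDerivAt φ (φ₁ r) r) (h₂ : ∀ r, HasDerivAt φ₁ (φ₂ r) r) :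
    pd i (pd j (fun z => φ ‖z + v‖)) x =
      (φ₂ ‖x + v‖ * ‖x + v‖ - φ₁ ‖x + v‖) / ‖x + v‖ ^ 3 * ((x + v) i * (x + v) j) +
        φ₁ ‖x + v‖ / ‖x + v‖ * (1 : Matrix (Fin n) (Fin n) ℝ) i j := by
  have hr : ‖x + v‖ ≠ 0 := norm_ne_zero_iff.2 h
  have hev : pd j (fun z => φ ‖z + v‖) =ᶠ[𝓝 x]
      fun z => (fun r => φ₁ r / r) ‖z + v‖ * (z + v) j := by
    have : ∀ᶠ z in 𝓝 x, z + v ≠ 0 :=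
      (continuous_id.add continuous_const).continuousAt.eventually_ne h
    filter_upwards [this] with z hz
    exact pd_radial j hz (h₁ _)
  have hψ : HasDerivAt (fun r => φ₁ r / r)
      ((φ₂ ‖x + v‖ * ‖x + v‖ - φ₁ ‖x + v‖ * 1) / ‖x + v‖ ^ 2) ‖x + v‖ :=
    (h₂ _).div (hasDerivAt_id _) hr
  have hc : HasFDerivAt (fun z : EuclideanSpace ℝ (Fin n) => (z + v) j)
      (EuclideanSpace.proj (𝕜 := ℝ) j) x :=
    (EuclideanSpace.proj (𝕜 := ℝ) j).hasFDerivAt.comp x ((hasFDerivAt_id x).add_const v)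
  have hmul : HasFDerivAt (fun z => (fun r => φ₁ r / r) ‖z + v‖ * (z + v) j) _ x :=
    (hasFDerivAt_radial h hψ).mul hc
  rw [pd, hev.fderiv_eq, hmul.fderiv]
  simp [EuclideanSpace.inner_single_right, Matrix.one_apply, eq_comm]
  field_simp
  ring

end RadialFunctions

section MatrixEstimates

variable {n : ℕ}

theorem abs_inv_sub_one_le {G : Matrix (Fin n) (Fin n) ℝ} {δ : ℝ} (hG : IsUnit G.det)
    (hδ : ∀ i j, |G i j - (1 : Matrix (Fin n) (Fin n) ℝ) i j| ≤ δ) (hnδ : n * δ ≤ 1 / 2) :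
    (∀ i j, |G⁻¹ i j| ≤ 2) ∧
      ∀ i j, |G⁻¹ i j - (1 : Matrix (Fin n) (Fin n) ℝ) i j| ≤ 2 * (n * δ) := by
  have hkey : ∀ M : ℝ, (∀ i j, |G⁻¹ i j| ≤ M) →
      ∀ i j, |G⁻¹ i j - (1 : Matrix (Fin n) (Fin n) ℝ) i j| ≤ M * (n * δ) := by
    intro M hM i j
    have h1 : (1 : Matrix (Fin n) (Fin n) ℝ) - G⁻¹ = G⁻¹ * (G - 1) := by
      rw [mul_sub, Matrix.nonsing_inv_mul _ hG, mul_one]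
    have h2 := congrFun (congrFun h1 i) j
    rw [abs_sub_comm, ← Matrix.sub_apply, h2, Matrix.mul_apply]
    calc |∑ k, G⁻¹ i k * (G - 1) k j| ≤ ∑ k : Fin n, M * δ := by
          refine (abs_sum_le_sum_abs _ _).trans (sum_le_sum fun k _ => ?_)
          rw [abs_mul]
          exact mul_le_mul (hM i k) (hδ k j) (abs_nonneg _) ((abs_nonneg _).trans (hM i k))
      _ = M * (n * δ) := by simp; ring
  have h2 : ∀ i j, |G⁻¹ i j| ≤ 2 := by
    intro i j
    obtain ⟨⟨i₀, j₀⟩, -, hmax⟩ := exists_max_image (univ : Finset (Fin n × Fin n))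
      (fun p => |G⁻¹ p.1 p.2|) ⟨(i, j), mem_univ _⟩
    have hM : ∀ i j, |G⁻¹ i j| ≤ |G⁻¹ i₀ j₀| := fun i j => hmax (i, j) (mem_univ _)
    have h3 := hkey _ hM i₀ j₀
    have h4 : |(1 : Matrix (Fin n) (Fin n) ℝ) i₀ j₀| ≤ 1 := by
      rw [Matrix.one_apply]; split_ifs <;> simp
    have h5 := abs_sub_abs_le_abs_sub (G⁻¹ i₀ j₀) ((1 : Matrix (Fin n) (Fin n) ℝ) i₀ j₀)
    have h6 := mul_le_mul_of_nonneg_left hnδ (abs_nonneg (G⁻¹ i₀ j₀))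
    linarith [hM i j]
  exact ⟨h2, hkey 2 h2⟩

theorem abs_quadratic_sub_norm_sq_le {A : Matrix (Fin n) (Fin n) ℝ} {δ : ℝ}
    (hA : ∀ i j, |A i j - (1 : Matrix (Fin n) (Fin n) ℝ) i j| ≤ δ)
    (y : EuclideanSpace ℝ (Fin n)) :
    |∑ i, ∑ j, A i j * (y i * y j) - ‖y‖ ^ 2| ≤ n ^ 2 * δ * ‖y‖ ^ 2 := by
  have h1 : ‖y‖ ^ 2 = ∑ i, ∑ j, (1 : Matrix (Fin n) (Fin n) ℝ) i j * (y i * y j) := by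
    rw [EuclideanSpace.real_norm_sq_eq]
    simp [Matrix.one_apply, pow_two]
  have h2 : ∀ i, |y i| ≤ ‖y‖ := fun i => by simpa using PiLp.norm_apply_le y i
  calc |∑ i, ∑ j, A i j * (y i * y j) - ‖y‖ ^ 2|
      = |∑ i, ∑ j, (A i j - (1 : Matrix (Fin n) (Fin n) ℝ) i j) * (y i * y j)| := by
        rw [h1, ← sum_sub_distrib]
        simp only [← sum_sub_distrib, sub_mul]
    _ ≤ ∑ i : Fin n, ∑ j : Fin n, δ * (‖y‖ * ‖y‖) := by
        refine (abs_sum_le_sum_abs _ _).trans (sum_le_sum fun i _ => ?_)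
        refine (abs_sum_le_sum_abs _ _).trans (sum_le_sum fun j _ => ?_)
        rw [abs_mul, abs_mul]
        have := (abs_nonneg _).trans (hA i j)
        gcongr
        exacts [hA i j, h2 i, h2 j]
    _ = n ^ 2 * δ * ‖y‖ ^ 2 := by simp; ring

theorem abs_christoffel_le {g : EuclideanSpace ℝ (Fin n) → Matrix (Fin n) (Fin n) ℝ}
    {x : EuclideanSpace ℝ (Fin n)} {M c : ℝ} (hM : ∀ i j, |(g x)⁻¹ i j| ≤ M)
    (hg : ∀ i j k, |pd k (fun y => g y i j) x| ≤ c) (k i j : Fin n) :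
    |christoffel g k i j x| ≤ 3 / 2 * n * M * c := by
  rw [christoffel, abs_mul, abs_of_pos (by norm_num : (0 : ℝ) < 1 / 2)]
  have : |∑ l, (g x)⁻¹ k l * (pd i (fun y => g y j l) x + pd j (fun y => g y i l) x -
      pd l (fun y => g y i j) x)| ≤ ∑ l : Fin n, M * (3 * c) := by
    refine (abs_sum_le_sum_abs _ _).trans (sum_le_sum fun l _ => ?_)
    rw [abs_mul]
    refine mul_le_mul (hM k l) ?_ (abs_nonneg _) ((abs_nonneg _).trans (hM k l))
    have h1 := abs_le.1 (hg j l i)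
    have h2 := abs_le.1 (hg i l j)
    have h3 := abs_le.1 (hg i j l)
    exact abs_le.2 ⟨by linarith, by linarith⟩
  simp at this
  linarith

theorem laplaceBeltrami_radial {g : EuclideanSpace ℝ (Fin n) → Matrix (Fin n) (Fin n) ℝ}
    {φ φ₁ φ₂ : ℝ → ℝ} {x v : EuclideanSpace ℝ (Fin n)}
    (h : x + v ≠ 0) (h₁ : ∀ r, HasDerivAt φ (φ₁ r) r) (h₂ : ∀ r, HasDerivAt φ₁ (φ₂ r) r) :
    laplaceBeltrami g (fun z => φ ‖z + v‖) x =
      (φ₂ ‖x + v‖ * ‖x + v‖ - φ₁ ‖x + v‖) / ‖x + v‖ ^ 3 *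
        ∑ i, ∑ j, (g x)⁻¹ i j * ((x + v) i * (x + v) j) +
      φ₁ ‖x + v‖ / ‖x + v‖ *
        ∑ i, ∑ j, (g x)⁻¹ i j * ((1 : Matrix (Fin n) (Fin n) ℝ) i j -
          ∑ k, christoffel g k i j x * (x + v) k) := by
  rw [laplaceBeltrami]
  simp only [pd_pd_radial _ _ h h₁ h₂, pd_radial _ h (h₁ _), mul_sum, ← sum_add_distrib]
  refine sum_congr rfl fun i _ => sum_congr rfl fun j _ => ?_
  have : ∑ k, christoffel g k i j x * (φ₁ ‖x + v‖ / ‖x + v‖ * (x + v) k) =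
      φ₁ ‖x + v‖ / ‖x + v‖ * ∑ k, christoffel g k i j x * (x + v) k := by
    rw [mul_sum]
    exact sum_congr rfl fun k _ => by ring
  rw [this]
  ring

theorem abs_lower_order_le {g : EuclideanSpace ℝ (Fin n) → Matrix (Fin n) (Fin n) ℝ}
    {x y : EuclideanSpace ℝ (Fin n)} {M c : ℝ} (hM : ∀ i j, |(g x)⁻¹ i j| ≤ M)
    (hg : ∀ i j k, |pd k (fun y => g y i j) x| ≤ c) (hM₀ : 0 ≤ M) :
    |∑ i, ∑ j, (g x)⁻¹ i j * ((1 : Matrix (Fin n) (Fin n) ℝ) i j -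
      ∑ k, christoffel g k i j x * y k)| ≤
      M * n + 3 / 2 * n ^ 4 * M ^ 2 * c * ‖y‖ := by
  have h2 : ∀ i, |y i| ≤ ‖y‖ := fun i => by simpa using PiLp.norm_apply_le y i
  calc _ ≤ ∑ i : Fin n, ∑ j : Fin n, M * ((1 : Matrix (Fin n) (Fin n) ℝ) i j +
        ∑ k : Fin n, 3 / 2 * n * M * c * ‖y‖) := by
        refine (abs_sum_le_sum_abs _ _).trans (sum_le_sum fun i _ => ?_)
        refine (abs_sum_le_sum_abs _ _).trans (sum_le_sum fun j _ => ?_)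
        rw [abs_mul]
        refine mul_le_mul (hM i j) ?_ (abs_nonneg _) hM₀
        refine (abs_sub _ _).trans (add_le_add ?_ ?_)
        · rw [Matrix.one_apply]; split_ifs <;> simp
        · refine (abs_sum_le_sum_abs _ _).trans (sum_le_sum fun k _ => ?_)
          rw [abs_mul]
          have h3 := abs_christoffel_le hM hg k i j
          exact mul_le_mul h3 (h2 k) (abs_nonneg _) ((abs_nonneg _).trans h3)
    _ = M * n + 3 / 2 * n ^ 4 * M ^ 2 * c * ‖y‖ := by
        simp [← mul_sum, sum_add_distrib, Matrix.one_apply]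
        ring

end MatrixEstimates

section Bump

theorem hasDerivAt_expNegInvGlue (t : ℝ) :
    HasDerivAt expNegInvGlue (t⁻¹ ^ 2 * expNegInvGlue t) t := by
  simpa using expNegInvGlue.hasDerivAt_polynomial_eval_inv_mul 1 t

theorem hasDerivAt_inv_sq_mul_expNegInvGlue (t : ℝ) :
    HasDerivAt (fun s => s⁻¹ ^ 2 * expNegInvGlue s)
      ((t⁻¹ ^ 4 - 2 * t⁻¹ ^ 3) * expNegInvGlue t) t := by
  have := expNegInvGlue.hasDerivAt_polynomial_eval_inv_mul (Polynomial.X ^ 2) t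
  convert this using 1
  · simp
  · simp
    ring_nf
    tauto

variable {n : ℕ}

theorem bumpF_eq_expNegInvGlue (iN : Fin n) (ε : ℝ) :
    bumpF iN ε = fun x =>
      (fun r : ℝ => expNegInvGlue ((2 * ε - r) / (n + 2)))
        ‖x + ε • EuclideanSpace.single iN (1 : ℝ)‖ := by
  have hN : (0 : ℝ) < n + 2 := by positivity
  ext x
  simp only [bumpF, expNegInvGlue]
  by_cases h : ‖x + ε • EuclideanSpace.single iN (1 : ℝ)‖ < 2 * ε
  · have : ¬ (2 * ε - ‖x + ε • EuclideanSpace.single iN (1 : ℝ)‖) / ((n : ℝ) + 2) ≤ 0 :=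
      not_le.2 (div_pos (by linarith) hN)
    rw [if_pos h, if_neg this, inv_div, neg_div]
  · have : (2 * ε - ‖x + ε • EuclideanSpace.single iN (1 : ℝ)‖) / ((n : ℝ) + 2) ≤ 0 :=
      div_nonpos_of_nonpos_of_nonneg (by linarith) hN.le
    rw [if_neg h, if_pos this]

theorem le_norm_add_smul_single {iN : Fin n} {ε : ℝ} {x : EuclideanSpace ℝ (Fin n)}
    (hx : x ∈ halfSpace iN) : ε ≤ ‖x + ε • EuclideanSpace.single iN (1 : ℝ)‖ := by
  have h := PiLp.norm_apply_le (x + ε • EuclideanSpace.single iN (1 : ℝ)) iN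
  have hx' : 0 ≤ x iN := hx
  simp at h
  linarith [le_abs_self (x iN + ε)]

theorem contDiffOn_bumpF (iN : Fin n) {ε : ℝ} (hε : 0 < ε) :
    ContDiffOn ℝ (⊤ : ℕ∞) (bumpF iN ε) (halfSpace iN) := by
  rw [bumpF_eq_expNegInvGlue]
  intro x hx
  have h : x + ε • EuclideanSpace.single iN (1 : ℝ) ≠ 0 :=
    norm_pos_iff.1 (hε.trans_le (le_norm_add_smul_single hx))
  have h1 : ContDiffAt ℝ (⊤ : ℕ∞)
      (fun z => ‖z + ε • EuclideanSpace.single iN (1 : ℝ)‖) x :=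
    (contDiffAt_id.add contDiffAt_const).norm ℝ h
  exact (expNegInvGlue.contDiff.contDiffAt.comp x
    ((contDiffAt_const.sub h1).div_const _)).contDiffWithinAt

theorem radial_operator_pos {N s r Q T C E ε : ℝ} (hN : 5 ≤ N) (hs : 0 < s) (hsε : s ≤ ε)
    (hεr : ε ≤ r) (hε : ε ≤ 1) (hQ : r ^ 2 / 2 ≤ Q) (hT : T ≤ C) (hC : ε * C ≤ 1)
    (hE : 0 < E) :
    0 < (((s / N)⁻¹ ^ 4 - 2 * (s / N)⁻¹ ^ 3) * E / N ^ 2 * r - -((s / N)⁻¹ ^ 2 * E / N)) /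
      r ^ 3 * Q + -((s / N)⁻¹ ^ 2 * E / N) / r * T := by
  have hN0 : 0 < N := by linarith
  have hr : 0 < r := by linarith
  have hfac : (((s / N)⁻¹ ^ 4 - 2 * (s / N)⁻¹ ^ 3) * E / N ^ 2 * r - -((s / N)⁻¹ ^ 2 * E / N)) /
      r ^ 3 * Q + -((s / N)⁻¹ ^ 2 * E / N) / r * T =
      E * N / (s ^ 4 * r) * ((N - 2 * s) * (Q / r ^ 2) * r + s ^ 2 * (Q / r ^ 2) - s ^ 2 * T) := by
    field_simp
    ring
  rw [hfac]
  refine mul_pos (by positivity) ?_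
  have hq : 1 / 2 ≤ Q / r ^ 2 := by
    rw [le_div_iff₀ (by positivity)]; linarith
  have h1 : 3 * (1 / 2) * r ≤ (N - 2 * s) * (Q / r ^ 2) * r := by
    gcongr
    · linarith
    · linarith
  have h2 : s ^ 2 * T ≤ r := by
    rcases le_or_gt T 0 with h | h
    · nlinarith [sq_nonneg s]
    · have h3 : s * T ≤ 1 := by nlinarith
      nlinarith
  have h4 : 0 ≤ s ^ 2 * (Q / r ^ 2) := by positivity
  linarith

theorem laplaceBeltrami_bumpF {g : EuclideanSpace ℝ (Fin n) → Matrix (Fin n) (Fin n) ℝ}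
    {iN : Fin n} {ε : ℝ} {x : EuclideanSpace ℝ (Fin n)}
    (h : x + ε • EuclideanSpace.single iN (1 : ℝ) ≠ 0) :
    laplaceBeltrami g (bumpF iN ε) x =
      (let y := x + ε • EuclideanSpace.single iN (1 : ℝ)
       let t := (2 * ε - ‖y‖) / (n + 2)
       ((t⁻¹ ^ 4 - 2 * t⁻¹ ^ 3) * expNegInvGlue t / (n + 2) ^ 2 * ‖y‖ -
          -(t⁻¹ ^ 2 * expNegInvGlue t / (n + 2))) / ‖y‖ ^ 3 *
        ∑ i, ∑ j, (g x)⁻¹ i j * (y i * y j) +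
      -(t⁻¹ ^ 2 * expNegInvGlue t / (n + 2)) / ‖y‖ *
        ∑ i, ∑ j, (g x)⁻¹ i j * ((1 : Matrix (Fin n) (Fin n) ℝ) i j -
          ∑ k, christoffel g k i j x * y k)) := by
  have hN : (n : ℝ) + 2 ≠ 0 := by positivity
  have ht : ∀ r : ℝ, HasDerivAt (fun r : ℝ => (2 * ε - r) / ((n : ℝ) + 2)) (-1 / (n + 2)) r :=
    fun r => ((hasDerivAt_id r).const_sub (2 * ε)).div_const _
  rw [bumpF_eq_expNegInvGlue]
  refine laplaceBeltrami_radial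
    (φ := fun r => expNegInvGlue ((2 * ε - r) / (n + 2)))
    (v := ε • EuclideanSpace.single iN (1 : ℝ))
    (φ₁ := fun r => -(((2 * ε - r) / (n + 2))⁻¹ ^ 2 *
      expNegInvGlue ((2 * ε - r) / (n + 2)) / (n + 2)))
    (φ₂ := fun r => (((2 * ε - r) / (n + 2))⁻¹ ^ 4 - 2 * ((2 * ε - r) / (n + 2))⁻¹ ^ 3) *
      expNegInvGlue ((2 * ε - r) / (n + 2)) / (n + 2) ^ 2) h (fun r => ?_) (fun r => ?_)
  · refine ((hasDerivAt_expNegInvGlue _).comp r (ht r)).congr_deriv ?_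
    ring
  · refine ((((hasDerivAt_inv_sq_mul_expNegInvGlue _).comp r (ht r)).div_const
      ((n : ℝ) + 2)).neg).congr_deriv ?_
    field_simp

end Bump

/-- the bump `f_ε` is `g`-subharmonic for any metric close to the
Euclidean one. -/
theorem stmt8 (n : ℕ) (hn : 3 ≤ n) (iN : Fin n) (hiN : (iN : ℕ) = n - 1)
    (c : ℝ) (hc : 0 < c) :
    ∃ ε₀ : ℝ, 0 < ε₀ ∧ ε₀ ≤ 1 ∧ ∀ ε : ℝ, 0 < ε → ε ≤ ε₀ →
      ContDiffOn ℝ (⊤ : ℕ∞) (bumpF iN ε) (halfSpace iN) ∧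
      (∀ x ∈ halfSpace iN, 0 ≤ bumpF iN ε x) ∧
      (∀ x ∈ halfSpace iN, bumpF iN ε x ≠ 0 →
        ‖x + ε • EuclideanSpace.single iN (1 : ℝ)‖ ≤ 2 * ε) ∧
      ∀ g : EuclideanSpace ℝ (Fin n) → Matrix (Fin n) (Fin n) ℝ,
        IsCmMetric 1 iN g →
        (∀ x ∈ halfSpace iN, ‖x + ε • EuclideanSpace.single iN (1 : ℝ)‖ ≤ 2 * ε →
          (∀ i j, |g x i j - (1 : Matrix (Fin n) (Fin n) ℝ) i j| ≤ c * ε) ∧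
          (∀ i j k, |pd k (fun y => g y i j) x| ≤ c)) →
        (∀ x ∈ halfSpace iN, 0 ≤ laplaceBeltrami g (bumpF iN ε) x) ∧
        (∀ x ∈ halfSpace iN, ‖x + ε • EuclideanSpace.single iN (1 : ℝ)‖ < 2 * ε →
          0 < laplaceBeltrami g (bumpF iN ε) x) := by
  have hn3 : (3 : ℝ) ≤ n := by exact_mod_cast hn
  have hn0 : (0 : ℝ) < n := by linarith
  set C : ℝ := 2 * n + 12 * n ^ 4 * c with hCdef
  have hC0 : 0 < C := by positivity
  set K : ℝ := C + 4 * n ^ 3 * c with hKdef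
  have hK1 : 1 ≤ K := by
    have : 0 < 12 * (n : ℝ) ^ 4 * c + 4 * n ^ 3 * c := by positivity
    linarith
  have hK0 : 0 < K := by linarith
  refine ⟨1 / K, by positivity, (div_le_one hK0).2 hK1, fun ε hε hεK => ?_⟩
  have hεK' : ε * K ≤ 1 := (le_div_iff₀ hK0).1 hεK
  have hε1 : ε ≤ 1 := hεK.trans ((div_le_one hK0).2 hK1)
  have hεC : ε * C ≤ 1 := by
    have : 0 ≤ ε * (4 * n ^ 3 * c) := by positivity
    nlinarith
  have hεn : 4 * (n : ℝ) ^ 3 * c * ε ≤ 1 := by nlinarith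
  have hpos : ∀ g : EuclideanSpace ℝ (Fin n) → Matrix (Fin n) (Fin n) ℝ, IsCmMetric 1 iN g →
      (∀ x ∈ halfSpace iN, ‖x + ε • EuclideanSpace.single iN (1 : ℝ)‖ ≤ 2 * ε →
        (∀ i j, |g x i j - (1 : Matrix (Fin n) (Fin n) ℝ) i j| ≤ c * ε) ∧
        (∀ i j k, |pd k (fun y => g y i j) x| ≤ c)) →
      ∀ x ∈ halfSpace iN, ‖x + ε • EuclideanSpace.single iN (1 : ℝ)‖ < 2 * ε →
        0 < laplaceBeltrami g (bumpF iN ε) x := by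
    intro g hg hgb x hx hlt
    obtain ⟨hg0, hg1⟩ := hgb x hx hlt.le
    have hle : ε ≤ ‖x + ε • EuclideanSpace.single iN (1 : ℝ)‖ := le_norm_add_smul_single hx
    rw [laplaceBeltrami_bumpF (norm_pos_iff.1 (hε.trans_le hle))]
    set y := x + ε • EuclideanSpace.single iN (1 : ℝ)
    have hsmall : (n : ℝ) * (c * ε) ≤ 1 / 4 := by
      have h1 : (n : ℝ) ≤ n ^ 3 := le_self_pow₀ (by linarith) (by norm_num)
      have h2 : (n : ℝ) * (c * ε) ≤ n ^ 3 * (c * ε) := by gcongr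
      linarith
    obtain ⟨hinv, hinv1⟩ := abs_inv_sub_one_le
      ((Matrix.isUnit_iff_isUnit_det _).1 (hg.2 x hx).2.isUnit) hg0 (by linarith)
    have hQ := (abs_le.1 (abs_quadratic_sub_norm_sq_le hinv1 y)).1
    have hT := (le_abs_self _).trans (abs_lower_order_le (y := y) hinv hg1 (by norm_num))
    refine radial_operator_pos (ε := ε) (C := C) (by linarith) (by linarith) (by linarith) hle hε1
      ?_ (hT.trans ?_) hεC
      (expNegInvGlue.pos_of_pos (div_pos (by linarith) (by linarith)))
    · have : (n : ℝ) ^ 2 * (2 * (n * (c * ε))) * ‖y‖ ^ 2 ≤ 1 / 2 * ‖y‖ ^ 2 := by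
        gcongr
        linarith
      linarith
    · have : 6 * (n : ℝ) ^ 4 * c * ‖y‖ ≤ 6 * n ^ 4 * c * 2 := by
        gcongr
        linarith
      linarith
  have hnonneg : ∀ x, 0 ≤ bumpF iN ε x := fun x => by
    rw [bumpF_eq_expNegInvGlue]
    exact expNegInvGlue.nonneg _
  refine ⟨contDiffOn_bumpF iN hε, fun x _ => hnonneg x, fun x _ hne => ?_,
    fun g hg hgb => ⟨fun x hx => ?_, hpos g hg hgb⟩⟩
  · by_contra hlt
    exact hne (if_neg fun h => hlt h.le)
  · by_cases hlt : ‖x + ε • EuclideanSpace.single iN (1 : ℝ)‖ < 2 * ε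
    · exact (hpos g hg hgb x hx hlt).le
    · rw [laplaceBeltrami_bumpF
        (norm_pos_iff.1 (hε.trans_le (le_norm_add_smul_single hx)))]
      have : (2 * ε - ‖x + ε • EuclideanSpace.single iN (1 : ℝ)‖) / ((n : ℝ) + 2) ≤ 0 :=
        div_nonpos_of_nonpos_of_nonneg (by linarith) (by linarith)
      simp [expNegInvGlue.zero_of_nonpos this]

end
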